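/- Let 1 ≤ c ≤ n and let L ⊆ ℝ^n be a c-dimensional linear subspace. Then: (1) L is nonnegative ⟺ var(v) < c for all v ∈ L ∖ {0} ⟺ varbar(w) ≥ c for all w ∈ L^⊥ ∖ {0}; (2) L is positive ⟺ varbar(v) < c for all v ∈ L ∖ {0} ⟺ var(w) ≥ c for all w ∈ L^⊥ ∖ {0}. -/

import Mathlib

open Matrix

/-- All maximal (`c × c`) minors of a `c × n` real matrix are positive. -/
def AllMinorsPos {c n : ℕ} (A : Matrix (Fin c) (Fin n) ℝ) : Prop :=
  ∀ s : Fin c → Fin n, StrictMono s → 0 < (A.submatrix id s).det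

/-- All maximal (`c × c`) minors of a `c × n` real matrix are nonnegative. -/
def AllMinorsNonneg {c n : ℕ} (A : Matrix (Fin c) (Fin n) ℝ) : Prop :=
  ∀ s : Fin c → Fin n, StrictMono s → 0 ≤ (A.submatrix id s).det

/-- A `c`-dimensional linear subspace of `ℝⁿ` is positive if it is the row space of a real
`c × n` matrix of rank `c` all of whose `c × c` minors are positive. -/
def IsPositiveSubspace {n : ℕ} (c : ℕ) (L : Submodule ℝ (Fin n → ℝ)) : Prop :=
  ∃ A : Matrix (Fin c) (Fin n) ℝ, A.rank = c ∧
    L = Submodule.span ℝ (Set.range fun i => A i) ∧ AllMinorsPos A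

/-- A `c`-dimensional linear subspace of `ℝⁿ` is nonnegative if it is the row space of a real
`c × n` matrix of rank `c` all of whose `c × c` minors are nonnegative. -/
def IsNonnegSubspace {n : ℕ} (c : ℕ) (L : Submodule ℝ (Fin n → ℝ)) : Prop :=
  ∃ A : Matrix (Fin c) (Fin n) ℝ, A.rank = c ∧
    L = Submodule.span ℝ (Set.range fun i => A i) ∧ AllMinorsNonneg A

/-- Coordinatewise imaginary part of a point of `ℂⁿ`. -/
def imPart {n : ℕ} (x : Fin n → ℂ) : Fin n → ℝ := fun i => (x i).im

/-- A subset of `ℂⁿ` is positively hyperbolic of codimension `c` if the imaginary part of any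
of its points does not lie in `L \ {0}` for any positive `c`-dimensional subspace `L ⊆ ℝⁿ`. -/
def PosHyperbolic {n : ℕ} (c : ℕ) (X : Set (Fin n → ℂ)) : Prop :=
  ∀ L : Submodule ℝ (Fin n → ℝ), IsPositiveSubspace c L →
    ∀ x ∈ X, ¬ (imPart x ∈ L ∧ imPart x ≠ 0)
/-- `var v`: the number of sign changes in the sequence `v 0, …, v (n-1)` after deleting
zeroes.  Equivalently, it is the largest `k` admitting indices `s 0 < s 1 < ⋯ < s k` such
that consecutive chosen entries have (nonzero) opposite signs. -/
noncomputable def var {n : ℕ} (v : Fin n → ℝ) : ℕ :=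
  sSup {k | ∃ s : Fin (k + 1) → Fin n, StrictMono s ∧
    ∀ j : Fin k, v (s j.castSucc) * v (s j.succ) < 0}

/-- `varbar v`: the maximal number of sign changes obtainable by freely reassigning the
entries of `v` that are zero. -/
noncomputable def varbar {n : ℕ} (v : Fin n → ℝ) : ℕ :=
  sSup {k | ∃ w : Fin n → ℝ, (∀ i, v i ≠ 0 → w i = v i) ∧ k = var w}

/-- The orthogonal complement of a real subspace of `ℝⁿ` with respect to the standard inner
product. -/
def orthComp {n : ℕ} (K : Submodule ℝ (Fin n → ℝ)) : Submodule ℝ (Fin n → ℝ) where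
  carrier := {w : Fin n → ℝ | ∀ v ∈ K, ∑ i, v i * w i = 0}
  add_mem' := by
    intro a b ha hb v hv
    have ha' := ha v hv
    have hb' := hb v hv
    simp only [Set.mem_setOf_eq] at *
    simp [Pi.add_apply, mul_add, Finset.sum_add_distrib, ha', hb']
  zero_mem' := by intro v hv; simp
  smul_mem' := by
    intro c a ha v hv
    have ha' := ha v hv
    simp only [Set.mem_setOf_eq] at *
    calc ∑ i, v i * (c • a) i = c * ∑ i, v i * a i := by
          rw [Finset.mul_sum]
          exact Finset.sum_congr rfl fun i _ => by simp [smul_eq_mul]; ring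
      _ = 0 := by rw [ha', mul_zero]

open Filter Topology

/-- `v` attains strictly alternating signs along some `k + 1` increasing positions. -/
def AltStrict {n : ℕ} (v : Fin n → ℝ) (k : ℕ) : Prop :=
  ∃ s : Fin (k + 1) → Fin n, StrictMono s ∧ ∃ e : ℝ, (e = 1 ∨ e = -1) ∧
    ∀ j : Fin (k + 1), 0 < e * (-1) ^ (j : ℕ) * v (s j)

/-- `v` attains weakly alternating signs along some `k + 1` increasing positions. -/
def AltWeak {n : ℕ} (v : Fin n → ℝ) (k : ℕ) : Prop :=
  ∃ s : Fin (k + 1) → Fin n, StrictMono s ∧ ∃ e : ℝ, (e = 1 ∨ e = -1) ∧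
    ∀ j : Fin (k + 1), 0 ≤ e * (-1) ^ (j : ℕ) * v (s j)

/-- Multiply the `i`-th entry by `(-1) ^ i`. -/
def alternate {n : ℕ} (v : Fin n → ℝ) : Fin n → ℝ := fun i => (-1) ^ (i : ℕ) * v i

theorem alternate_alternate {n : ℕ} (v : Fin n → ℝ) : alternate (alternate v) = v := by
  ext i
  simp [alternate, ← mul_assoc, ← mul_pow]

theorem alternate_ne_zero {n : ℕ} {v : Fin n → ℝ} (hv : v ≠ 0) : alternate v ≠ 0 := by
  intro h
  apply hv
  rw [← alternate_alternate v, h]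
  ext i
  simp [alternate]

theorem AltStrict.altWeak {n k : ℕ} {v : Fin n → ℝ} (h : AltStrict v k) : AltWeak v k := by
  obtain ⟨s, hs, e, he, h⟩ := h
  exact ⟨s, hs, e, he, fun j => (h j).le⟩

theorem AltStrict.mono {n k l : ℕ} {v : Fin n → ℝ} (h : AltStrict v k) (hl : l ≤ k) :
    AltStrict v l := by
  obtain ⟨s, hs, e, he, h⟩ := h
  refine ⟨s ∘ Fin.castLE (by omega), hs.comp (Fin.strictMono_castLE _), e, he, fun j => ?_⟩
  exact h (Fin.castLE (by omega) j)

theorem AltWeak.mono {n k l : ℕ} {v : Fin n → ℝ} (h : AltWeak v k) (hl : l ≤ k) :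
    AltWeak v l := by
  obtain ⟨s, hs, e, he, h⟩ := h
  refine ⟨s ∘ Fin.castLE (by omega), hs.comp (Fin.strictMono_castLE _), e, he, fun j => ?_⟩
  exact h (Fin.castLE (by omega) j)

theorem AltStrict.lt {n k : ℕ} {v : Fin n → ℝ} (h : AltStrict v k) : k < n := by
  obtain ⟨s, hs, -⟩ := h
  simpa using Fintype.card_le_of_injective s hs.injective

theorem AltStrict.ne_zero {n k : ℕ} {v : Fin n → ℝ} (h : AltStrict v k) : v ≠ 0 := by
  rintro rfl
  obtain ⟨s, -, e, -, h⟩ := h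
  simpa using h 0

theorem altStrict_zero {n : ℕ} {v : Fin n → ℝ} (hv : v ≠ 0) : AltStrict v 0 := by
  obtain ⟨i, hi⟩ := Function.ne_iff.mp hv
  refine ⟨fun _ => i, Subsingleton.strictMono (α := Fin 1) _, ?_⟩
  rcases lt_or_gt_of_ne hi with h | h
  · exact ⟨-1, by simp, fun j => by simpa [Fin.val_eq_zero] using h⟩
  · exact ⟨1, by simp, fun j => by simpa [Fin.val_eq_zero] using h⟩

theorem altStrict_iff {n k : ℕ} {v : Fin n → ℝ} (hv : v ≠ 0) :
    AltStrict v k ↔ ∃ s : Fin (k + 1) → Fin n, StrictMono s ∧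
      ∀ j : Fin k, v (s j.castSucc) * v (s j.succ) < 0 := by
  constructor
  · rintro ⟨s, hs, e, he, h⟩
    refine ⟨s, hs, fun j => ?_⟩
    have h1 := h j.castSucc
    have h2 := h j.succ
    simp only [Fin.val_castSucc, Fin.val_succ, pow_succ] at h1 h2
    rcases he with rfl | rfl <;> rcases neg_one_pow_eq_or ℝ (j : ℕ) with hj | hj <;>
      rw [hj] at h1 h2 <;> nlinarith
  · rintro ⟨s, hs, h⟩
    rcases k.eq_zero_or_pos with rfl | hk
    · exact altStrict_zero hv
    have key : ∀ e : ℝ, 0 < e * v (s 0) → ∀ j : Fin (k + 1),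
        0 < e * (-1) ^ (j : ℕ) * v (s j) := by
      intro e he j
      induction j using Fin.induction with
      | zero => simpa using he
      | succ j ih =>
        have := h j
        simp only [Fin.val_castSucc, Fin.val_succ, pow_succ] at ih ⊢
        rcases pos_and_pos_or_neg_and_neg_of_mul_pos ih with ⟨h1, h2⟩ | ⟨h1, h2⟩ <;> nlinarith
    have h0 : v (s 0) ≠ 0 := by
      intro h0
      have := h ⟨0, hk⟩
      have h1 : (Fin.castSucc ⟨0, hk⟩ : Fin (k + 1)) = 0 := rfl
      rw [h1, h0] at this
      simp at this
    refine ⟨s, hs, ?_⟩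
    rcases lt_or_gt_of_ne h0 with h | h
    · exact ⟨-1, by simp, key (-1) (by linarith)⟩
    · exact ⟨1, by simp, key 1 (by linarith)⟩

theorem le_var_iff {n k : ℕ} {v : Fin n → ℝ} (hv : v ≠ 0) : k ≤ var v ↔ AltStrict v k := by
  have hset : {k | ∃ s : Fin (k + 1) → Fin n, StrictMono s ∧
      ∀ j : Fin k, v (s j.castSucc) * v (s j.succ) < 0} = {k | AltStrict v k} := by
    ext k
    exact (altStrict_iff hv).symm
  have hbdd : BddAbove {k | AltStrict v k} := ⟨n, fun k hk => hk.lt.le⟩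
  rw [var, hset]
  exact ⟨fun h => (Nat.sSup_mem ⟨0, altStrict_zero hv⟩ hbdd : AltStrict v _).mono h,
    fun h => le_csSup hbdd h⟩

theorem var_lt_iff {n k : ℕ} {v : Fin n → ℝ} (hv : v ≠ 0) : var v < k ↔ ¬ AltStrict v k := by
  rw [← le_var_iff hv, not_le]

theorem le_varbar_iff {n k : ℕ} {v : Fin n → ℝ} (hv : v ≠ 0) : k ≤ varbar v ↔ AltWeak v k := by
  have hw : ∀ w : Fin n → ℝ, (∀ i, v i ≠ 0 → w i = v i) → w ≠ 0 := by
    rintro w hw rfl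
    obtain ⟨i, hi⟩ := Function.ne_iff.mp hv
    exact hi (hw i hi).symm
  have hbdd : BddAbove {k | ∃ w : Fin n → ℝ, (∀ i, v i ≠ 0 → w i = v i) ∧ k = var w} := by
    refine ⟨n, ?_⟩
    rintro k ⟨w, h, rfl⟩
    exact ((le_var_iff (hw w h)).mp le_rfl).lt.le
  constructor
  · intro h
    have hne : {k | ∃ w : Fin n → ℝ, (∀ i, v i ≠ 0 → w i = v i) ∧ k = var w}.Nonempty :=
      ⟨var v, v, fun _ _ => rfl, rfl⟩
    obtain ⟨w, hwv, hk⟩ := Nat.sSup_mem hne hbdd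
    have h' : k ≤ var w := by rw [← hk]; exact h
    obtain ⟨s, hs, e, he, h⟩ := (le_var_iff (hw w hwv)).mp h'
    refine ⟨s, hs, e, he, fun j => ?_⟩
    by_cases h0 : v (s j) = 0
    · simp [h0]
    · rw [← hwv _ h0]
      exact (h j).le
  · rintro ⟨s, hs, e, he, h⟩
    classical
    let w : Fin n → ℝ := fun i => if v i ≠ 0 then v i else
      if hi : ∃ j, s j = i then e * (-1) ^ (hi.choose : ℕ) else 0
    have hwv : ∀ i, v i ≠ 0 → w i = v i := fun i hi => if_pos hi
    refine le_trans ((le_var_iff (hw w hwv)).mpr ⟨s, hs, e, he, fun j => ?_⟩)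
      (le_csSup hbdd ⟨w, hwv, rfl⟩)
    by_cases h0 : v (s j) = 0
    · have hj : ∃ i, s i = s j := ⟨j, rfl⟩
      have hc : hj.choose = j := hs.injective hj.choose_spec
      have : w (s j) = e * (-1) ^ (j : ℕ) := by
        simp only [w, h0, ne_eq, not_true_eq_false, if_false, dif_pos hj, hc]
      rw [this]
      have : e ≠ 0 := by rcases he with rfl | rfl <;> norm_num
      exact mul_self_pos.mpr (by positivity)
    · rw [hwv _ h0]
      refine lt_of_le_of_ne (h j) (Ne.symm ?_)
      have : e ≠ 0 := by rcases he with rfl | rfl <;> norm_num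
      positivity

theorem varbar_lt_iff {n k : ℕ} {v : Fin n → ℝ} (hv : v ≠ 0) :
    varbar v < k ↔ ¬ AltWeak v k := by
  rw [← le_varbar_iff hv, not_le]

theorem count_range_eq_card {m n : ℕ} {s : Fin m → Fin n} (hs : StrictMono s) (l : ℕ)
    [DecidablePred fun x : ℕ => ∃ j, (s j : ℕ) = x] :
    Nat.count (fun x => ∃ j, (s j : ℕ) = x) l =
      (Finset.univ.filter fun j => (s j : ℕ) < l).card := by
  rw [Nat.count_eq_card_filter_range, ← Finset.card_image_of_injective
    (Finset.univ.filter fun j => (s j : ℕ) < l) (Fin.val_injective.comp hs.injective)]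
  congr 1
  ext x
  simp only [Finset.mem_filter, Finset.mem_range, Finset.mem_image, Finset.mem_univ, true_and,
    Function.comp_apply]
  constructor
  · rintro ⟨hx, j, rfl⟩
    exact ⟨j, hx, rfl⟩
  · rintro ⟨j, hj, rfl⟩
    exact ⟨hj, j, rfl⟩

theorem count_range_apply {m n : ℕ} {s : Fin m → Fin n} (hs : StrictMono s) (a : Fin m)
    [DecidablePred fun x : ℕ => ∃ j, (s j : ℕ) = x] :
    Nat.count (fun x => ∃ j, (s j : ℕ) = x) (s a) = a := by
  rw [count_range_eq_card hs, show (Finset.univ.filter fun j => (s j : ℕ) < s a) = Finset.Iio a by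
    ext; simp [hs.lt_iff_lt], Fin.card_Iio]

theorem count_range_top {m n : ℕ} {s : Fin m → Fin n} (hs : StrictMono s)
    [DecidablePred fun x : ℕ => ∃ j, (s j : ℕ) = x] :
    Nat.count (fun x => ∃ j, (s j : ℕ) = x) n = m := by
  rw [count_range_eq_card hs]
  simp

theorem AltStrict.add_lt_of_altWeak_alternate {n k m : ℕ} {v : Fin n → ℝ} (h : AltStrict v k)
    (h' : AltWeak (alternate v) m) : k + m < n := by
  classical
  obtain ⟨s, hs, e, he, h⟩ := h
  obtain ⟨t, ht, f, hf, h'⟩ := h'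
  have parity : ∀ a b, s a = t b → (-1 : ℝ) ^ ((a : ℕ) + b + s a) = e * f := by
    intro a b hab
    have h1 := h a
    have h2 := h' b
    rw [← hab] at h2
    simp only [alternate] at h2
    have h3 : v (s a) ≠ 0 := by
      intro h0
      simp [h0] at h1
    rw [pow_add, pow_add]
    rcases he with rfl | rfl <;> rcases hf with rfl | rfl <;>
      rcases neg_one_pow_eq_or ℝ (a : ℕ) with ha | ha <;>
      rcases neg_one_pow_eq_or ℝ (b : ℕ) with hb | hb <;>
      rcases neg_one_pow_eq_or ℝ (s a : ℕ) with hx | hx <;>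
      rw [ha] at h1 <;> rw [hb, hx] at h2 <;> rw [ha, hb, hx] <;> norm_num <;>
      linarith
  obtain ⟨q, hq, hodd⟩ : ∃ q : ℕ, q ≤ 1 ∧
      ∀ a b, s a = t b → Odd ((a : ℕ) + b + s a + q) := by
    have hef : e * f = 1 ∨ e * f = -1 := by
      rcases he with rfl | rfl <;> rcases hf with rfl | rfl <;> norm_num
    rcases hef with hef | hef
    · refine ⟨1, le_rfl, fun a b hab => ?_⟩
      have := (neg_one_pow_eq_one_iff_even (by norm_num : (-1 : ℝ) ≠ 1)).mp
        ((parity a b hab).trans hef)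
      exact this.add_one
    · refine ⟨0, by norm_num, fun a b hab => ?_⟩
      exact (neg_one_pow_eq_neg_one_iff_odd (by norm_num : (-1 : ℝ) ≠ 1)).mp
        ((parity a b hab).trans hef)
  have key : ∀ l ≤ n, Nat.count (fun x => ∃ j, (s j : ℕ) = x) l +
      Nat.count (fun x => ∃ j, (t j : ℕ) = x) l ≤ l + q := by
    intro l
    induction l with
    | zero => simp
    | succ l ih =>
      intro hl
      have ih := ih (by omega)
      rw [Nat.count_succ, Nat.count_succ]
      split_ifs with h1 h2 h2
      · obtain ⟨a, ha⟩ := h1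
        obtain ⟨b, hb⟩ := h2
        have := hodd a b (Fin.ext (ha.trans hb.symm))
        have ca := count_range_apply hs a
        have cb := count_range_apply ht b
        rw [ha] at ca this
        rw [hb] at cb
        rw [ca, cb] at ih ⊢
        obtain ⟨z, hz⟩ := this
        omega
      · omega
      · omega
      · omega
  have := key n le_rfl
  rw [count_range_top hs, count_range_top ht] at this
  omega

theorem exists_alternating_chains (u : ℕ → ℝ) (hu : ∀ i, u i ≠ 0) (N : ℕ) :
    ∃ k m, k + m = N ∧
      (∃ s : ℕ → ℕ, (∀ i j, i < j → j ≤ k → s i < s j) ∧ s k = N ∧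
        ∀ j ≤ k, 0 < u 0 * (-1) ^ j * u (s j)) ∧
      (∃ s : ℕ → ℕ, (∀ i j, i < j → j ≤ m → s i < s j) ∧ s m = N ∧
        ∀ j ≤ m, 0 < u 0 * (-1) ^ j * ((-1) ^ s j * u (s j))) := by
  induction N with
  | zero =>
    refine ⟨0, 0, rfl, ⟨id, fun _ _ h _ => h, rfl, ?_⟩, ⟨id, fun _ _ h _ => h, rfl, ?_⟩⟩ <;>
    · intro j hj
      obtain rfl : j = 0 := by omega
      simpa using mul_self_pos.mpr (hu 0)
  | succ N ih =>
    obtain ⟨k, m, hkm, ⟨s, hs, hsN, h⟩, ⟨t, ht, htN, h'⟩⟩ := ih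
    have hk := h k le_rfl
    have hm := h' m le_rfl
    rw [hsN] at hk
    rw [htN] at hm
    have sk : ∀ i < k, s i < N := fun i hi => hsN ▸ hs i k hi le_rfl
    have tm : ∀ i < m, t i < N := fun i hi => htN ▸ ht i m hi le_rfl
    rcases lt_or_gt_of_ne (mul_ne_zero (hu N) (hu (N + 1))) with hneg | hpos
    · refine ⟨k + 1, m, by omega,
        ⟨fun j => if j ≤ k then s j else N + 1, ?_, by simp, ?_⟩,
        ⟨fun j => if j < m then t j else N + 1, ?_, by simp, ?_⟩⟩
      · intro i j hij hj
        have := sk i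
        have := hs i j hij
        have : i = k → s i = N := fun h => h ▸ hsN
        dsimp only
        split_ifs <;> omega
      · intro j hj
        by_cases hjk : j ≤ k
        · simpa [hjk] using h j hjk
        · obtain rfl : j = k + 1 := by omega
          simp only [hjk, if_false, pow_succ]
          rcases pos_and_pos_or_neg_and_neg_of_mul_pos hk with ⟨h1, h2⟩ | ⟨h1, h2⟩ <;> nlinarith
      · intro i j hij hj
        have := tm i
        have := ht i j hij
        dsimp only
        split_ifs <;> omega
      · intro j hj
        by_cases hjm : j < m
        · simpa [hjm] using h' j hj
        · obtain rfl : j = m := by omega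
          simp only [hjm, if_false, pow_succ]
          rw [← mul_assoc] at hm ⊢
          rcases pos_and_pos_or_neg_and_neg_of_mul_pos hm with ⟨h1, h2⟩ | ⟨h1, h2⟩ <;> nlinarith
    · refine ⟨k, m + 1, by omega,
        ⟨fun j => if j < k then s j else N + 1, ?_, by simp, ?_⟩,
        ⟨fun j => if j ≤ m then t j else N + 1, ?_, by simp, ?_⟩⟩
      · intro i j hij hj
        have := sk i
        have := hs i j hij
        dsimp only
        split_ifs <;> omega
      · intro j hj
        by_cases hjk : j < k
        · simpa [hjk] using h j hj
        · obtain rfl : j = k := by omega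
          simp only [hjk, if_false]
          rcases pos_and_pos_or_neg_and_neg_of_mul_pos hk with ⟨h1, h2⟩ | ⟨h1, h2⟩ <;> nlinarith
      · intro i j hij hj
        have := tm i
        have := ht i j hij
        have : i = m → t i = N := fun h => h ▸ htN
        dsimp only
        split_ifs <;> omega
      · intro j hj
        by_cases hjm : j ≤ m
        · simpa [hjm] using h' j hjm
        · obtain rfl : j = m + 1 := by omega
          simp only [hjm, if_false, pow_succ]
          rw [← mul_assoc] at hm ⊢
          rcases pos_and_pos_or_neg_and_neg_of_mul_pos hm with ⟨h1, h2⟩ | ⟨h1, h2⟩ <;> nlinarith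

theorem exists_monotone_support_retraction {n : ℕ} {v : Fin n → ℝ} (hv : v ≠ 0) :
    ∃ r : ℕ → Fin n, Monotone r ∧ (∀ x, v (r x) ≠ 0) ∧ ∀ i : Fin n, v i ≠ 0 → r i = i := by
  classical
  obtain ⟨i₀, hi₀⟩ := Function.ne_iff.mp hv
  let S := Finset.univ.filter fun i => v i ≠ 0
  have hS : S.Nonempty := ⟨i₀, by simpa [S] using hi₀⟩
  let T : ℕ → Finset (Fin n) := fun x => insert (S.min' hS) (S.filter fun i => (i : ℕ) ≤ x)
  have hT : ∀ x, (T x).Nonempty := fun x => Finset.insert_nonempty _ _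
  have hTS : ∀ x, T x ⊆ S := fun x =>
    Finset.insert_subset (S.min'_mem hS) (Finset.filter_subset _ _)
  refine ⟨fun x => (T x).max' (hT x), fun x y hxy => ?_, fun x => ?_, fun i hi => ?_⟩
  · refine Finset.max'_subset _ (Finset.insert_subset_insert _ fun i hi => ?_)
    simp only [Finset.mem_filter] at hi ⊢
    exact ⟨hi.1, hi.2.trans hxy⟩
  · exact (Finset.mem_filter.mp (hTS x ((T x).max'_mem (hT x)))).2
  · have hiS : i ∈ S := by simpa [S] using hi
    refine le_antisymm (Finset.max'_le _ _ _ fun j hj => ?_) (Finset.le_max' _ _ ?_)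
    · rcases Finset.mem_insert.mp hj with rfl | hj
      · exact Finset.min'_le _ _ hiS
      · exact (Finset.mem_filter.mp hj).2
    · exact Finset.mem_insert_of_mem (Finset.mem_filter.mpr ⟨hiS, le_rfl⟩)

theorem altStrict_or_altWeak_alternate {n c : ℕ} (hc : c ≤ n) {v : Fin n → ℝ} (hv : v ≠ 0) :
    AltStrict v c ∨ AltWeak (alternate v) (n - c) := by
  obtain ⟨r, hr, hr0, hri⟩ := exists_monotone_support_retraction hv
  obtain ⟨k, m, hkm, ⟨s, hs, -, h⟩, ⟨t, ht, htN, h'⟩⟩ :=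
    exists_alternating_chains (fun x => v (r x)) hr0 (n - 1)
  have hn : 0 < n := (r 0).pos
  have hsign : ∃ e : ℝ, (e = 1 ∨ e = -1) ∧ ∀ y, 0 < v (r 0) * y → 0 < e * y := by
    rcases lt_or_gt_of_ne (hr0 0) with h0 | h0
    · exact ⟨-1, by simp, fun y hy => by nlinarith⟩
    · exact ⟨1, by simp, fun y hy => by nlinarith⟩
  obtain ⟨e, he, hsign⟩ := hsign
  rcases le_or_gt c k with hck | hck
  · left
    refine AltStrict.mono (k := k) ⟨fun j => r (s j), ?_, e, he, fun j => ?_⟩ hck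
    · rw [Fin.strictMono_iff_lt_succ]
      intro j
      refine lt_of_le_of_ne (hr (hs _ _ (by simp) (by simp)).le) fun heq => ?_
      have h1 := h j (by omega)
      have h2 := h (j + 1) (by omega)
      simp only [Fin.val_castSucc, Fin.val_succ] at heq
      rw [← heq, pow_succ] at h2
      linarith
    · rw [mul_assoc]
      exact hsign _ (by rw [← mul_assoc]; exact h j (by omega))
  · right
    have htn : ∀ j : Fin (m + 1), t j < n := by
      intro j
      rcases (show (j : ℕ) ≤ m by omega).eq_or_lt with hj | hj
      · rw [hj, htN]
        omega
      · have := ht j m hj le_rfl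
        omega
    refine AltWeak.mono (k := m) ⟨fun j => ⟨t j, htn j⟩, fun i j hij => ?_, e, he, fun j => ?_⟩
      (by omega)
    · exact ht i j hij (by omega)
    · by_cases h0 : v ⟨t j, htn j⟩ = 0
      · simp [alternate, h0]
      · have h1 := h' j (by omega)
        have h2 : r (t j) = ⟨t j, htn j⟩ := hri ⟨t j, htn j⟩ h0
        simp only [h2] at h1
        rw [mul_assoc]
        exact (hsign _ (by rw [← mul_assoc]; exact h1)).le

theorem altStrict_alternate_of_not_altWeak {n c : ℕ} (hc : c ≤ n) {v : Fin n → ℝ} (hv : v ≠ 0)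
    (h : ¬ AltWeak v c) : AltStrict (alternate v) (n - c) := by
  have := altStrict_or_altWeak_alternate (Nat.sub_le n c) (alternate_ne_zero hv)
  rw [alternate_alternate, Nat.sub_sub_self hc] at this
  exact this.resolve_right h

/-- A nonzero vector with `c` zeros has `c` weak sign changes. -/
theorem altWeak_of_card_zeros {n c : ℕ} {v : Fin n → ℝ} (hv : v ≠ 0) (Z : Finset (Fin n))
    (hZ : Z.card = c) (h : ∀ i ∈ Z, v i = 0) : AltWeak v c := by
  have hc : c ≤ n := by simpa [hZ] using Z.card_le_univ
  by_contra hw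
  obtain ⟨s, hs, e, -, hpos⟩ := altStrict_alternate_of_not_altWeak hc hv hw
  have hdisj : Disjoint Z (Finset.univ.map ⟨s, hs.injective⟩) := by
    rw [Finset.disjoint_right]
    intro i hi hiZ
    obtain ⟨j, -, rfl⟩ := Finset.mem_map.mp hi
    have h0 : v (s j) = 0 := h _ hiZ
    have := hpos j
    simp [alternate, h0] at this
  have := (Finset.card_union_of_disjoint hdisj).symm.trans_le (Finset.card_le_univ _)
  simp only [Finset.card_map, Finset.card_univ, Fintype.card_fin, hZ] at this
  omega

theorem mem_span_rows_iff {c n : ℕ} (A : Matrix (Fin c) (Fin n) ℝ) (v : Fin n → ℝ) :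
    v ∈ Submodule.span ℝ (Set.range fun i => A i) ↔ ∃ y : Fin c → ℝ, y ᵥ* A = v := by
  have := range_vecMulLinear A
  change v ∈ Submodule.span ℝ (Set.range A.row) ↔ _
  rw [← this]
  rfl

/-- Restricting a combination of rows to `c + 1` columns gives a linear relation between the
maximal minors on these columns. -/
theorem sum_vecMul_mul_minors {c n : ℕ} (A : Matrix (Fin c) (Fin n) ℝ) (σ : Fin (c + 1) → Fin n)
    (y : Fin c → ℝ) :
    ∑ j : Fin (c + 1), (-1) ^ (j : ℕ) * (y ᵥ* A) (σ j) * (A.submatrix id (σ ∘ j.succAbove)).det = 0 := by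
  let M : Matrix (Fin (c + 1)) (Fin (c + 1)) ℝ :=
    Fin.cons (fun j => (y ᵥ* A) (σ j)) fun i j => A i (σ j)
  have hM : M.det = 0 := by
    refine exists_vecMul_eq_zero_iff.mp ⟨Fin.cons (-1) y, ?_, ?_⟩
    · intro h
      simpa using congrFun h 0
    · ext j
      simp [M, vecMul, dotProduct, Fin.sum_univ_succ]
  rw [← hM, det_succ_row_zero]
  rfl

theorem eq_zero_of_vecMul_vanishes {c n : ℕ} {A : Matrix (Fin c) (Fin n) ℝ} {s : Fin c → Fin n}
    (hs : (A.submatrix id s).det ≠ 0) {y : Fin c → ℝ} (h : ∀ j, (y ᵥ* A) (s j) = 0) : y = 0 :=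
  eq_zero_of_vecMul_eq_zero hs (funext h)

theorem exists_vecMul_vanishes {c n : ℕ} {A : Matrix (Fin c) (Fin n) ℝ} {s : Fin c → Fin n}
    (hs : (A.submatrix id s).det = 0) : ∃ y ≠ 0, ∀ j, (y ᵥ* A) (s j) = 0 := by
  obtain ⟨y, hy, h⟩ := exists_vecMul_eq_zero_iff.mpr hs
  exact ⟨y, hy, fun j => congrFun h j⟩

theorem exists_mem_vanishing {n : ℕ} (L : Submodule ℝ (Fin n → ℝ)) (Z : Finset (Fin n))
    (hZ : Z.card < Module.finrank ℝ L) : ∃ v ∈ L, v ≠ 0 ∧ ∀ i ∈ Z, v i = 0 := by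
  let f : L →ₗ[ℝ] (Z → ℝ) := (LinearMap.funLeft ℝ ℝ (Subtype.val : Z → Fin n)).comp L.subtype
  have hf : LinearMap.ker f ≠ ⊥ := LinearMap.ker_ne_bot_of_finrank_lt (by simpa using hZ)
  obtain ⟨v, hv, hv0⟩ := (Submodule.ne_bot_iff _).mp hf
  exact ⟨v, v.2, by simpa using hv0, fun i hi => congrFun hv ⟨i, hi⟩⟩

theorem exists_minor_ne_zero {c n : ℕ} {A : Matrix (Fin c) (Fin n) ℝ} (hA : A.rank = c) :
    ∃ s : Fin c → Fin n, StrictMono s ∧ (A.submatrix id s).det ≠ 0 := by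
  classical
  obtain ⟨κ, a, ha, hspan, hli⟩ := exists_linearIndependent' ℝ A.col
  have : Finite κ := Finite.of_injective a ha
  have := Fintype.ofFinite κ
  have hcard : Fintype.card κ = c := by
    rw [← hA, rank_eq_finrank_span_cols, ← hspan, finrank_span_eq_card hli]
  let T : Finset (Fin n) := Finset.univ.map ⟨a, ha⟩
  have hT : T.card = c := by simp [T, hcard]
  refine ⟨T.orderEmbOfFin hT, (T.orderEmbOfFin hT).strictMono, ?_⟩
  have hk : ∀ j, ∃ k, a k = T.orderEmbOfFin hT j := fun j => by
    obtain ⟨k, -, hk⟩ := Finset.mem_map.mp (T.orderEmbOfFin_mem hT j)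
    exact ⟨k, hk⟩
  choose k hk using hk
  have hki : Function.Injective k := fun i j hij =>
    (T.orderEmbOfFin hT).injective (by rw [← hk, ← hk, hij])
  have hcols : LinearIndependent ℝ (A.submatrix id (T.orderEmbOfFin hT)).col := by
    have := hli.comp k hki
    have he : (A.col ∘ a) ∘ k = (A.submatrix id (T.orderEmbOfFin hT)).col := by
      ext j i
      simp [hk]
    rwa [he] at this
  rw [linearIndependent_cols_iff_isUnit, isUnit_iff_isUnit_det] at hcols
  exact hcols.ne_zero

theorem finrank_span_rows_of_minor_ne_zero {c n : ℕ} {A : Matrix (Fin c) (Fin n) ℝ}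
    {s : Fin c → Fin n} (hs : (A.submatrix id s).det ≠ 0) :
    Module.finrank ℝ (Submodule.span ℝ (Set.range fun i => A i)) = c := by
  have h : LinearIndependent ℝ A.row := by
    rw [← vecMul_injective_iff]
    refine (injective_iff_map_eq_zero A.vecMulLinear).mpr fun y hy => ?_
    exact eq_zero_of_vecMul_vanishes hs fun j => congrFun hy (s j)
  exact (finrank_span_eq_card h).trans (Fintype.card_fin c)

theorem AllMinorsPos.not_altWeak {c n : ℕ} {A : Matrix (Fin c) (Fin n) ℝ} (hA : AllMinorsPos A)
    {v : Fin n → ℝ} (hv : v ∈ Submodule.span ℝ (Set.range fun i => A i)) (hv0 : v ≠ 0) :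
    ¬ AltWeak v c := by
  rintro ⟨σ, hσ, e, he, h⟩
  obtain ⟨y, rfl⟩ := (mem_span_rows_iff A v).mp hv
  have hpos : ∀ j : Fin (c + 1), 0 < (A.submatrix id (σ ∘ j.succAbove)).det := fun j =>
    hA _ (hσ.comp (Fin.strictMono_succAbove j))
  have hsum : ∑ j : Fin (c + 1), e * (-1) ^ (j : ℕ) * (y ᵥ* A) (σ j) *
      (A.submatrix id (σ ∘ j.succAbove)).det = 0 := by
    rw [← mul_zero e, ← sum_vecMul_mul_minors A σ y, Finset.mul_sum]
    simp only [mul_assoc]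
  have hzero := (Finset.sum_eq_zero_iff_of_nonneg fun j _ =>
    mul_nonneg (h j) (hpos j).le).mp hsum
  have hvan : ∀ j, (y ᵥ* A) (σ j) = 0 := by
    intro j
    have := hzero j (Finset.mem_univ j)
    have he0 : e ≠ 0 := by rcases he with rfl | rfl <;> norm_num
    simpa [(hpos j).ne', he0] using this
  exact hv0 (by
    rw [eq_zero_of_vecMul_vanishes (hpos 0).ne' fun j => hvan _, zero_vecMul])

/-- Adjacent nonzero minors have equal signs when no combination of rows alternates too often. -/
theorem adjacent_minors_mul_pos {c n : ℕ} {A : Matrix (Fin c) (Fin n) ℝ}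
    (hA : ∀ y, ¬ AltStrict (y ᵥ* A) c) {σ : Fin (c + 1) → Fin n} (hσ : StrictMono σ)
    {a b : Fin (c + 1)} (hab : a ≠ b) (ha : (A.submatrix id (σ ∘ a.succAbove)).det ≠ 0)
    (hb : (A.submatrix id (σ ∘ b.succAbove)).det ≠ 0) :
    0 < (A.submatrix id (σ ∘ a.succAbove)).det * (A.submatrix id (σ ∘ b.succAbove)).det := by
  set D : Fin (c + 1) → ℝ := fun j => (A.submatrix id (σ ∘ j.succAbove)).det with hD
  change 0 < D a * D b
  change D a ≠ 0 at ha
  change D b ≠ 0 at hb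
  by_contra hneg
  have hlt : 0 < -(D a * D b) := by
    have := mul_ne_zero ha hb
    rcases lt_or_gt_of_ne this with h | h
    · linarith
    · exact absurd h hneg
  obtain ⟨ε, hε, hεlt⟩ := exists_pos_mul_lt hlt
    (∑ j ∈ (Finset.univ.erase a).erase b, D j * D a)
  let x : Fin c → ℝ := fun i => (-1) ^ (a.succAbove i : ℕ) * if a.succAbove i = b then 1 else ε
  obtain ⟨y, hy⟩ : ∃ y, y ᵥ* A.submatrix id (σ ∘ a.succAbove) = x := by
    refine ⟨x ᵥ* (A.submatrix id (σ ∘ a.succAbove))⁻¹, ?_⟩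
    rw [vecMul_vecMul, nonsing_inv_mul _ (isUnit_iff_ne_zero.mpr ha), vecMul_one]
  have hval : ∀ j, j ≠ a → (-1) ^ (j : ℕ) * (y ᵥ* A) (σ j) = if j = b then 1 else ε := by
    intro j hj
    obtain ⟨i, rfl⟩ := Fin.exists_succAbove_eq hj
    have : (y ᵥ* A) (σ (a.succAbove i)) = x i := congrFun hy i
    rw [this]
    simp only [x, ← mul_assoc, ← mul_pow]
    simp
  have hsum := sum_vecMul_mul_minors A σ y
  change ∑ j : Fin (c + 1), (-1) ^ (j : ℕ) * (y ᵥ* A) (σ j) * D j = 0 at hsum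
  rw [← Finset.add_sum_erase _ _ (Finset.mem_univ a),
    ← Finset.add_sum_erase _ _ (Finset.mem_erase.mpr ⟨hab.symm, Finset.mem_univ b⟩),
    hval b hab.symm, if_pos rfl, Finset.sum_congr rfl (g := fun j => ε * D j) (by
      intro j hj
      simp only [Finset.mem_erase] at hj
      rw [hval j hj.2.1, if_neg hj.1]), ← Finset.mul_sum] at hsum
  rw [← Finset.sum_mul] at hεlt
  have hva : 0 < (-1) ^ (a : ℕ) * (y ᵥ* A) (σ a) := by
    refine pos_of_mul_pos_left (b := D a * D a) ?_ (mul_self_nonneg _)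
    have : (-1) ^ (a : ℕ) * (y ᵥ* A) (σ a) * (D a * D a) = -(D a * D b) -
      (∑ j ∈ (Finset.univ.erase a).erase b, D j) * D a * ε := by linear_combination D a * hsum
    linarith
  refine hA y ⟨σ, hσ, 1, by simp, fun j => ?_⟩
  rw [one_mul]
  by_cases hj : j = a
  · rw [hj]
    exact hva
  · rw [hval j hj]
    split_ifs <;> linarith

theorem orderEmbOfFin_erase {n c : ℕ} (S : Finset (Fin n)) (hS : S.card = c + 1) (a : Fin (c + 1))
    (h : (S.erase (S.orderEmbOfFin hS a)).card = c) :
    ⇑((S.erase (S.orderEmbOfFin hS a)).orderEmbOfFin h) = S.orderEmbOfFin hS ∘ a.succAbove := by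
  symm
  refine Finset.orderEmbOfFin_unique h (fun i => ?_)
    ((S.orderEmbOfFin hS).strictMono.comp (Fin.strictMono_succAbove a))
  simp [Fin.succAbove_ne]

theorem minors_mul_pos {c n : ℕ} {A : Matrix (Fin c) (Fin n) ℝ}
    (hA : ∀ y, ¬ AltStrict (y ᵥ* A) c) (m : ℕ) :
    ∀ (T U : Finset (Fin n)) (hT : T.card = c) (hU : U.card = c), (T \ U).card = m →
      (A.submatrix id (T.orderEmbOfFin hT)).det ≠ 0 →
      (A.submatrix id (U.orderEmbOfFin hU)).det ≠ 0 →
      0 < (A.submatrix id (T.orderEmbOfFin hT)).det *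
        (A.submatrix id (U.orderEmbOfFin hU)).det := by
  classical
  induction m with
  | zero =>
    intro T U hT hU hm hDT hDU
    obtain rfl : T = U := Finset.eq_of_subset_of_card_le
      (Finset.sdiff_eq_empty_iff_subset.mp (Finset.card_eq_zero.mp hm)) (by omega)
    exact mul_self_pos.mpr hDT
  | succ m ih =>
    intro T U hT hU hm hDT hDU
    have vanish : ∀ {V : Finset (Fin n)} (hV : V.card = c)
        (_ : (A.submatrix id (V.orderEmbOfFin hV)).det ≠ 0) (y : Fin c → ℝ),
        (∀ i ∈ V, (y ᵥ* A) i = 0) → y = 0 := fun hV hD y h =>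
      eq_zero_of_vecMul_vanishes hD fun j => h _ (Finset.orderEmbOfFin_mem _ hV j)
    obtain ⟨t, ht⟩ := Finset.card_pos.mp (by omega : 0 < (T \ U).card)
    obtain ⟨htT, htU⟩ := Finset.mem_sdiff.mp ht
    obtain ⟨v, hvL, hv0, hvZ⟩ := exists_mem_vanishing
      (Submodule.span ℝ (Set.range fun i => A i)) (T.erase t) (by
        rw [finrank_span_rows_of_minor_ne_zero hDT, ← hT]
        exact Finset.card_erase_lt_of_mem htT)
    obtain ⟨y, rfl⟩ := (mem_span_rows_iff A v).mp hvL
    have hy0 : y ≠ 0 := by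
      rintro rfl
      simp at hv0
    obtain ⟨u, huU, hu⟩ : ∃ u ∈ U, (y ᵥ* A) u ≠ 0 := by
      by_contra! h
      exact hy0 (vanish hU hDU y h)
    have hut : u ≠ t := fun h => htU (h ▸ huU)
    have huT : u ∉ T := fun h => hu (hvZ u (Finset.mem_erase.mpr ⟨hut, h⟩))
    have hvt : (y ᵥ* A) t ≠ 0 := by
      intro h
      refine hy0 (vanish hT hDT y fun i hi => ?_)
      by_cases hit : i = t
      · rw [hit, h]
      · exact hvZ i (Finset.mem_erase.mpr ⟨hit, hi⟩)
    let S := insert u T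
    have hS : S.card = c + 1 := by rw [Finset.card_insert_of_notMem huT, hT]
    have hSt : (S.erase t).card = c := by
      rw [Finset.card_erase_of_mem (Finset.mem_insert_of_mem htT), hS, Nat.add_sub_cancel]
    have hSu : S.erase u = T := Finset.erase_insert huT
    have hD' : (A.submatrix id ((S.erase t).orderEmbOfFin hSt)).det ≠ 0 := by
      intro h0
      obtain ⟨x, hx0, hx⟩ := exists_vecMul_vanishes h0
      have hx : ∀ i ∈ S.erase t, (x ᵥ* A) i = 0 := by
        intro i hi
        have : i ∈ Set.range ((S.erase t).orderEmbOfFin hSt) := by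
          rw [Finset.range_orderEmbOfFin]
          exact hi
        obtain ⟨j, rfl⟩ := this
        exact hx j
      have hz : (y ᵥ* A) t • x - (x ᵥ* A) t • y = 0 := by
        refine vanish hT hDT _ fun i hi => ?_
        rw [sub_vecMul, smul_vecMul, smul_vecMul]
        by_cases hit : i = t
        · subst hit
          simp [mul_comm]
        · have h1 := hx i (Finset.mem_erase.mpr ⟨hit, Finset.mem_insert_of_mem hi⟩)
          have h2 := hvZ i (Finset.mem_erase.mpr ⟨hit, hi⟩)
          simp [h1, h2]
      have hzu := congrArg (fun z => (z ᵥ* A) u) hz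
      have hxu := hx u (Finset.mem_erase.mpr ⟨hut, Finset.mem_insert_self u T⟩)
      simp only [sub_vecMul, smul_vecMul, Pi.sub_apply, Pi.smul_apply, hxu, smul_eq_mul,
        mul_zero, zero_sub, zero_vecMul, Pi.zero_apply, neg_eq_zero, mul_eq_zero, hu,
        or_false] at hzu
      refine hx0 (vanish hT hDT x fun i hi => ?_)
      by_cases hit : i = t
      · rw [hit, hzu]
      · exact hx i (Finset.mem_erase.mpr ⟨hit, Finset.mem_insert_of_mem hi⟩)
    have hcard : (S.erase t \ U).card = m := by
      have : S.erase t \ U = (T \ U).erase t := by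
        ext i
        simp only [S, Finset.mem_sdiff, Finset.mem_erase, Finset.mem_insert]
        constructor
        · rintro ⟨⟨h1, rfl | h2⟩, h3⟩
          · exact absurd huU h3
          · exact ⟨h1, h2, h3⟩
        · rintro ⟨h1, h2, h3⟩
          exact ⟨⟨h1, Or.inr h2⟩, h3⟩
      rw [this, Finset.card_erase_of_mem ht, hm, Nat.add_sub_cancel]
    have h1 := ih (S.erase t) U hSt hU hcard hD' hDU
    have h2 : 0 < (A.submatrix id (T.orderEmbOfFin hT)).det *
        (A.submatrix id ((S.erase t).orderEmbOfFin hSt)).det := by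
      have hT' : (S.erase u).card = c := by rw [hSu, hT]
      have hDT' : (A.submatrix id (T.orderEmbOfFin hT)).det =
          (A.submatrix id ((S.erase u).orderEmbOfFin hT')).det := by simp only [hSu]
      rw [hDT'] at hDT ⊢
      obtain ⟨a, ha⟩ : ∃ a, S.orderEmbOfFin hS a = u := by
        have : u ∈ Set.range (S.orderEmbOfFin hS) := by simp [S]
        exact this
      obtain ⟨b, hb⟩ : ∃ b, S.orderEmbOfFin hS b = t := by
        have : t ∈ Set.range (S.orderEmbOfFin hS) := by simp [S, htT]
        exact this
      clear_value S
      subst ha hb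
      rw [orderEmbOfFin_erase] at hDT hD' ⊢
      rw [orderEmbOfFin_erase]
      exact adjacent_minors_mul_pos hA (S.orderEmbOfFin hS).strictMono
        (fun h => hut (by rw [h])) hDT hD'
    nlinarith [mul_pos h1 h2, mul_self_pos.mpr hD']

theorem isNonnegSubspace_of_not_altStrict {n c : ℕ} {L : Submodule ℝ (Fin n → ℝ)}
    (hdim : Module.finrank ℝ L = c) (hL : ∀ v ∈ L, v ≠ 0 → ¬ AltStrict v c) :
    IsNonnegSubspace c L := by
  classical
  let b := Module.finBasisOfFinrankEq ℝ L hdim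
  let A : Matrix (Fin c) (Fin n) ℝ := fun i => b i
  have hspan : Submodule.span ℝ (Set.range fun i => A i) = L := by
    have := congrArg (Submodule.map L.subtype) b.span_eq
    rw [Submodule.map_span, ← Set.range_comp, Submodule.map_top, Submodule.range_subtype] at this
    exact this
  have hrank : A.rank = c := by
    rw [rank_eq_finrank_span_row]
    exact (congrArg (fun M : Submodule ℝ (Fin n → ℝ) => Module.finrank ℝ M) hspan).trans hdim
  have hA : ∀ y, ¬ AltStrict (y ᵥ* A) c := fun y h =>
    hL _ (hspan ▸ (mem_span_rows_iff A _).mpr ⟨y, rfl⟩) h.ne_zero h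
  have hsame : ∀ s t : Fin c → Fin n, StrictMono s → StrictMono t →
      0 ≤ (A.submatrix id s).det * (A.submatrix id t).det := by
    intro s t hs ht
    by_cases hDs : (A.submatrix id s).det = 0
    · simp [hDs]
    by_cases hDt : (A.submatrix id t).det = 0
    · simp [hDt]
    have hmap : ∀ {s : Fin c → Fin n} (hs : StrictMono s), ∃ (T : Finset (Fin n))
        (hT : T.card = c), s = T.orderEmbOfFin hT := fun {s} hs =>
      ⟨Finset.univ.map ⟨s, hs.injective⟩, by simp,
        Finset.orderEmbOfFin_unique _ (fun i => by simp) hs⟩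
    obtain ⟨T, hT, rfl⟩ := hmap hs
    obtain ⟨U, hU, rfl⟩ := hmap ht
    exact (minors_mul_pos hA _ T U hT hU rfl hDs hDt).le
  obtain ⟨s₀, hs₀, hD₀⟩ := exists_minor_ne_zero hrank
  rcases lt_or_gt_of_ne hD₀ with hneg | hpos
  · have hc : 0 < c := by
      rcases c.eq_zero_or_pos with rfl | h
      · simp at hneg
        linarith
      · exact h
    let d : Fin c → ℝ := Function.update 1 ⟨0, hc⟩ (-1)
    have hd : (diagonal d).det = -1 := by
      rw [det_diagonal, Finset.prod_update_of_mem (Finset.mem_univ _)]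
      simp
    have hdd : diagonal d * diagonal d = 1 := by
      rw [diagonal_mul_diagonal, ← diagonal_one]
      congr 1
      ext i
      by_cases hi : i = ⟨0, hc⟩ <;> simp [d, hi]
    have hminor : ∀ s : Fin c → Fin n,
        ((diagonal d * A).submatrix id s).det = -(A.submatrix id s).det := by
      intro s
      have : (diagonal d * A).submatrix id s = diagonal d * A.submatrix id s := by
        ext i j
        simp [diagonal_mul]
      rw [this, det_mul, hd, neg_one_mul]
    have hspan' : L = Submodule.span ℝ (Set.range fun i => (diagonal d * A) i) := by
      ext v
      rw [← hspan, mem_span_rows_iff, mem_span_rows_iff]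
      constructor
      · rintro ⟨y, rfl⟩
        exact ⟨y ᵥ* diagonal d, by rw [vecMul_vecMul, ← Matrix.mul_assoc, hdd, Matrix.one_mul]⟩
      · rintro ⟨y, rfl⟩
        exact ⟨y ᵥ* diagonal d, by rw [vecMul_vecMul]⟩
    refine ⟨diagonal d * A, ?_, hspan', fun s hs => ?_⟩
    · rw [rank_eq_finrank_span_row]
      exact (congrArg (fun M : Submodule ℝ (Fin n → ℝ) => Module.finrank ℝ M) hspan').symm.trans
        hdim
    · rw [hminor]
      have := hsame s s₀ hs hs₀
      nlinarith
  · refine ⟨A, hrank, hspan.symm, fun s hs => ?_⟩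
    have := hsame s s₀ hs hs₀
    nlinarith

theorem isPositiveSubspace_of_not_altWeak {n c : ℕ} {L : Submodule ℝ (Fin n → ℝ)}
    (hdim : Module.finrank ℝ L = c) (hL : ∀ v ∈ L, v ≠ 0 → ¬ AltWeak v c) :
    IsPositiveSubspace c L := by
  obtain ⟨A, hrank, rfl, hA⟩ := isNonnegSubspace_of_not_altStrict hdim
    fun v hv hv0 h => hL v hv hv0 h.altWeak
  refine ⟨A, hrank, rfl, fun s hs => lt_of_le_of_ne (hA s hs) fun h0 => ?_⟩
  obtain ⟨y, hy, hvan⟩ := exists_vecMul_vanishes h0.symm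
  obtain ⟨s₀, -, hD₀⟩ := exists_minor_ne_zero hrank
  have hv0 : y ᵥ* A ≠ 0 := fun h => hy (eq_zero_of_vecMul_vanishes hD₀ fun j => congrFun h _)
  refine hL _ ((mem_span_rows_iff A _).mpr ⟨y, rfl⟩) hv0
    (altWeak_of_card_zeros hv0 (Finset.univ.map ⟨s, hs.injective⟩) (by simp) ?_)
  intro i hi
  obtain ⟨j, -, rfl⟩ := Finset.mem_map.mp hi
  exact hvan j

/-- A predicate on strictly increasing sequences that is unaffected by raising one term by one
is constant. -/
theorem iff_of_raise_invariant {c n : ℕ} {Q : (Fin c → Fin n) → Prop}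
    (hQ : ∀ (r : Fin c → Fin n) (k : Fin c) (i : Fin n), StrictMono r →
      StrictMono (Function.update r k i) → (i : ℕ) = r k + 1 →
      (Q r ↔ Q (Function.update r k i)))
    {p q : Fin c → Fin n} (hp : StrictMono p) (hq : StrictMono q) : Q p ↔ Q q := by
  have key : ∀ (m : ℕ) (p q : Fin c → Fin n), StrictMono p → StrictMono q → p ≤ q →
      ∑ k, ((q k : ℕ) - p k) = m → (Q p ↔ Q q) := by
    intro m
    induction m using Nat.strong_induction_on with
    | _ m ih =>
      intro p q hp hq hpq hm
      rcases eq_or_ne p q with rfl | hne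
      · rfl
      obtain ⟨k, hkS, hlast⟩ : ∃ k, p k < q k ∧ ∀ l, k < l → p l = q l := by
        have hS : (Finset.univ.filter fun k => p k < q k).Nonempty := by
          by_contra h
          rw [Finset.not_nonempty_iff_eq_empty, Finset.filter_eq_empty_iff] at h
          exact hne (funext fun k => le_antisymm (hpq k) (not_lt.mp (h (Finset.mem_univ k))))
        obtain ⟨k, hk, hmax⟩ := Finset.exists_max_image _ id hS
        refine ⟨k, (Finset.mem_filter.mp hk).2, fun l hl => ?_⟩
        by_contra hne'
        exact absurd hl (not_lt.mpr (hmax l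
          (Finset.mem_filter.mpr ⟨Finset.mem_univ l, lt_of_le_of_ne (hpq l) hne'⟩)))
      have hin : (p k : ℕ) + 1 < n := lt_of_le_of_lt hkS (q k).2
      set p' := Function.update p k ⟨p k + 1, hin⟩ with hp'
      have hpk : p' k = ⟨p k + 1, hin⟩ := by simp [hp']
      have hpl : ∀ l, l ≠ k → p' l = p l := fun l hl => by simp [hp', hl]
      have hle : p' ≤ q := by
        intro l
        by_cases hl : l = k
        · subst hl
          rw [hpk]
          exact hkS
        · rw [hpl l hl]
          exact hpq l
      have hmono : StrictMono p' := by
        intro a b hab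
        by_cases hb : b = k
        · subst hb
          rw [hpk, hpl a hab.ne]
          have := hp hab
          rw [Fin.lt_def] at this ⊢
          simp only
          omega
        · rw [hpl b hb]
          by_cases ha : a = k
          · rw [ha] at hab ⊢
            rw [hlast b hab]
            exact lt_of_le_of_lt (hle k) (hq hab)
          · rw [hpl a ha]
            exact hp hab
      rw [hQ p k _ hp hmono rfl]
      refine ih _ ?_ p' q hmono hq hle rfl
      rw [← hm]
      refine Finset.sum_lt_sum (fun l _ => ?_) ⟨k, Finset.mem_univ k, ?_⟩
      · by_cases hl : l = k
        · rw [hl, hpk]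
          simp only
          omega
        · rw [hpl l hl]
      · rw [hpk]
        rw [Fin.lt_def] at hkS
        simp only
        omega
  have hmax : StrictMono fun k => max (p k) (q k) := fun a b hab => max_lt_max (hp hab) (hq hab)
  exact (key _ p _ hp hmax (fun k => le_max_left _ _) rfl).trans
    (key _ q _ hq hmax (fun k => le_max_right _ _) rfl).symm

theorem minor_mul_transvection_of_forall_ne {c n : ℕ} (A : Matrix (Fin c) (Fin n) ℝ)
    {i j : Fin n} (t : ℝ) {s : Fin c → Fin n} (hs : ∀ k, s k ≠ j) :
    ((A * transvection i j t).submatrix id s).det = (A.submatrix id s).det := by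
  congr 1
  ext a b
  simp [mul_transvection_apply_of_ne _ _ _ _ (hs b)]

theorem minor_mul_transvection {c n : ℕ} (A : Matrix (Fin c) (Fin n) ℝ)
    (i : Fin n) (t : ℝ) {s : Fin c → Fin n} (hs : Function.Injective s) (k : Fin c) :
    ((A * transvection i (s k) t).submatrix id s).det =
      (A.submatrix id s).det + t * (A.submatrix id (Function.update s k i)).det := by
  have h1 : (A * transvection i (s k) t).submatrix id s =
      (A.submatrix id s).updateCol k ((fun a => A a (s k)) + t • fun a => A a i) := by
    ext a b
    by_cases hb : b = k
    · subst hb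
      simp
    · simp [hb, mul_transvection_apply_of_ne _ _ _ _ (hs.ne hb)]
  have h2 : (A.submatrix id s).updateCol k (fun a => A a (s k)) = A.submatrix id s := by
    ext a b
    by_cases hb : b = k
    · subst hb
      simp
    · simp [hb]
  have h3 : (A.submatrix id s).updateCol k (fun a => A a i) =
      A.submatrix id (Function.update s k i) := by
    ext a b
    by_cases hb : b = k
    · subst hb
      simp
    · simp [hb]
  rw [h1, det_updateCol_add, det_updateCol_smul, h2, h3]

theorem minor_le_minor_mul_transvection {c n : ℕ} {A : Matrix (Fin c) (Fin n) ℝ}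
    (hA : AllMinorsNonneg A) {i j : Fin n} (hij : (i : ℕ) = j + 1 ∨ (j : ℕ) = i + 1)
    {t : ℝ} (ht : 0 ≤ t) {s : Fin c → Fin n} (hs : StrictMono s) :
    (A.submatrix id s).det ≤ ((A * transvection i j t).submatrix id s).det := by
  by_cases hj : ∃ k, s k = j
  · obtain ⟨k, rfl⟩ := hj
    rw [minor_mul_transvection A i t hs.injective k]
    suffices h : 0 ≤ (A.submatrix id (Function.update s k i)).det by
      linarith [mul_nonneg ht h]
    by_cases hi : ∃ l, s l = i
    · obtain ⟨l, rfl⟩ := hi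
      have hlk : l ≠ k := by
        rintro rfl
        omega
      refine (det_zero_of_column_eq hlk fun a => ?_).ge
      simp [hlk]
    · push Not at hi
      refine hA _ fun a b hab => ?_
      have hab' := hs hab
      have ha := hi a
      have hb := hi b
      simp only [Function.update_apply]
      split_ifs with h1 h2 h2
      · exact absurd (h1.trans h2.symm) hab.ne
      · subst h1
        omega
      · subst h2
        omega
      · exact hab'
  · push Not at hj
    rw [minor_mul_transvection_of_forall_ne A t hj]

/-- A matrix with nonnegative maximal minors, not all zero, can be perturbed on the right to one
with positive maximal minors. -/
theorem AllMinorsNonneg.exists_allMinorsPos_mul {c n : ℕ} {A : Matrix (Fin c) (Fin n) ℝ}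
    (hA : AllMinorsNonneg A) {s₀ : Fin c → Fin n} (hs₀ : StrictMono s₀)
    (hD : (A.submatrix id s₀).det ≠ 0) {U : Set (Matrix (Fin n) (Fin n) ℝ)} (hU : U ∈ 𝓝 1) :
    ∃ G ∈ U, AllMinorsPos (A * G) := by
  classical
  induction hm : (Finset.univ.filter fun s : Fin c → Fin n =>
      StrictMono s ∧ (A.submatrix id s).det = 0).card using Nat.strong_induction_on
      generalizing A U with
  | _ m ih =>
    by_cases hpos : AllMinorsPos A
    · exact ⟨1, mem_of_mem_nhds hU, by rwa [Matrix.mul_one]⟩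
    obtain ⟨s₁, hs₁, hD₁⟩ : ∃ s, StrictMono s ∧ (A.submatrix id s).det = 0 := by
      simp only [AllMinorsPos, not_forall] at hpos
      obtain ⟨s, hs, h⟩ := hpos
      exact ⟨s, hs, le_antisymm (not_lt.mp h) (hA s hs)⟩
    obtain ⟨s, k, i, hs, hadj, hs0, hmono, hne⟩ : ∃ (s : Fin c → Fin n) (k : Fin c) (i : Fin n),
        StrictMono s ∧ ((i : ℕ) = s k + 1 ∨ (s k : ℕ) = i + 1) ∧ (A.submatrix id s).det = 0 ∧
        StrictMono (Function.update s k i) ∧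
        (A.submatrix id (Function.update s k i)).det ≠ 0 := by
      by_contra! hcon
      refine hD ((iff_of_raise_invariant (Q := fun r => (A.submatrix id r).det = 0)
        (fun r k i hr hr' hi => ⟨fun h => hcon r k i hr (Or.inl hi) h hr', fun h => ?_⟩)
        hs₁ hs₀).mp hD₁)
      have := hcon (Function.update r k i) k (r k) hr' (by simp [hi]) h (by simpa using hr)
      simpa using this
    obtain ⟨V, hV, W, hW, hVW⟩ : ∃ V ∈ 𝓝 (1 : Matrix (Fin n) (Fin n) ℝ), ∃ W ∈ 𝓝 1,
        ∀ E ∈ V, ∀ G ∈ W, E * G ∈ U := by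
      have hcont : Continuous fun x : Matrix (Fin n) (Fin n) ℝ × Matrix (Fin n) (Fin n) ℝ =>
        x.1 * x.2 := continuous_fst.matrix_mul continuous_snd
      have := hcont.tendsto (1, 1)
      rw [Matrix.mul_one] at this
      obtain ⟨V, hV, W, hW, h⟩ := mem_nhds_prod_iff.mp (this hU)
      exact ⟨V, hV, W, hW, fun E hE G hG => h (Set.mk_mem_prod hE hG)⟩
    obtain ⟨t, ht, htV⟩ : ∃ t : ℝ, 0 < t ∧ transvection i (s k) t ∈ V := by
      have hcont : Continuous fun t : ℝ => transvection i (s k) t := by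
        refine continuous_matrix fun a b => ?_
        simp only [transvection, Matrix.add_apply, single_apply]
        split_ifs <;> fun_prop
      have h0 : Tendsto (fun t : ℝ => transvection i (s k) t) (𝓝[>] 0) (𝓝 1) := by
        have := hcont.tendsto 0
        rw [transvection_zero] at this
        exact this.mono_left nhdsWithin_le_nhds
      exact ((eventually_mem_nhdsWithin (a := (0 : ℝ)) (s := Set.Ioi 0)).and (h0 hV)).exists
    have hge : ∀ r : Fin c → Fin n, StrictMono r → (A.submatrix id r).det ≤
        ((A * transvection i (s k) t).submatrix id r).det := fun r hr =>
      minor_le_minor_mul_transvection hA hadj ht.le hr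
    have hraise : 0 < ((A * transvection i (s k) t).submatrix id s).det := by
      rw [minor_mul_transvection A i t hs.injective k, hs0, zero_add]
      exact mul_pos ht (lt_of_le_of_ne (hA _ hmono) hne.symm)
    have hA' : AllMinorsNonneg (A * transvection i (s k) t) := fun r hr =>
      (hA r hr).trans (hge r hr)
    have hlt : (Finset.univ.filter fun r : Fin c → Fin n => StrictMono r ∧
        ((A * transvection i (s k) t).submatrix id r).det = 0).card < m := by
      rw [← hm]
      refine Finset.card_lt_card ((Finset.ssubset_iff_of_subset fun r hr => ?_).mpr
        ⟨s, by simp [hs, hs0], by simp [hraise.ne']⟩)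
      simp only [Finset.mem_filter, Finset.mem_univ, true_and] at hr ⊢
      exact ⟨hr.1, le_antisymm ((hge r hr.1).trans hr.2.le) (hA r hr.1)⟩
    obtain ⟨G, hG, hGpos⟩ := ih _ hlt hA'
      ((lt_of_le_of_ne (hA _ hs₀) hD.symm).trans_le (hge s₀ hs₀)).ne' hW rfl
    exact ⟨transvection i (s k) t * G, hVW _ htV _ hG, by rwa [← Matrix.mul_assoc]⟩

theorem IsNonnegSubspace.not_altStrict {n c : ℕ} {L : Submodule ℝ (Fin n → ℝ)}
    (hL : IsNonnegSubspace c L) {v : Fin n → ℝ} (hv : v ∈ L) : ¬ AltStrict v c := by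
  rintro ⟨σ, hσ, e, he, h⟩
  obtain ⟨A, hrank, rfl, hA⟩ := hL
  obtain ⟨y, rfl⟩ := (mem_span_rows_iff A v).mp hv
  obtain ⟨s₀, hs₀, hD⟩ := exists_minor_ne_zero hrank
  have hU : {G : Matrix (Fin n) (Fin n) ℝ | ∀ j : Fin (c + 1),
      0 < e * (-1) ^ (j : ℕ) * (y ᵥ* (A * G)) (σ j)} ∈ 𝓝 1 := by
    refine IsOpen.mem_nhds ?_ (by simpa using h)
    rw [Set.ofPred_forall]
    refine isOpen_iInter_of_finite fun j => isOpen_lt continuous_const ?_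
    have hcont : Continuous fun G : Matrix (Fin n) (Fin n) ℝ => y ᵥ* (A * G) :=
      continuous_const.matrix_vecMul (continuous_const.matrix_mul continuous_id)
    exact continuous_const.mul ((continuous_apply (σ j)).comp hcont)
  obtain ⟨G, hG, hpos⟩ := hA.exists_allMinorsPos_mul hs₀ hD hU
  have halt : AltStrict (y ᵥ* (A * G)) c := ⟨σ, hσ, e, he, hG⟩
  exact hpos.not_altWeak ((mem_span_rows_iff _ _).mpr ⟨y, rfl⟩) halt.ne_zero halt.altWeak

theorem mem_orthComp_iff {n : ℕ} {L : Submodule ℝ (Fin n → ℝ)} {w : Fin n → ℝ} :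
    w ∈ orthComp L ↔ ∀ v ∈ L, ∑ i, v i * w i = 0 :=
  Iff.rfl

theorem altStrict_of_mem_orthComp {n c : ℕ} {L : Submodule ℝ (Fin n → ℝ)}
    (hdim : Module.finrank ℝ L = c) (hL : ∀ v ∈ L, v ≠ 0 → ¬ AltWeak v c)
    {w : Fin n → ℝ} (hw : w ∈ orthComp L) (hw0 : w ≠ 0) : AltStrict w c := by
  classical
  have hcn : c ≤ n := by
    rw [← hdim]
    simpa using Submodule.finrank_le L
  by_contra hcon
  obtain ⟨t, ht, f, hf, hwt⟩ := (altStrict_or_altWeak_alternate hcn hw0).resolve_left hcon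
  have hc0 : c ≠ 0 := by
    rintro rfl
    exact hcon (altStrict_zero hw0)
  set Z : Finset (Fin n) := (Finset.univ.image t)ᶜ with hZ
  have hZcard : Z.card = c - 1 := by
    rw [hZ, Finset.card_compl, Finset.card_image_of_injective _ ht.injective]
    simp
    omega
  have hZt : ∀ i, i ∉ Z → ∃ j, t j = i := fun i hi => by simpa [hZ] using hi
  have htZ : ∀ j, t j ∉ Z := fun j => by simp [hZ]
  obtain ⟨v, hv, hv0, hvZ⟩ := exists_mem_vanishing L Z (by omega)
  obtain ⟨t', ht', e, he, hvt⟩ := altStrict_alternate_of_not_altWeak hcn hv0 (hL v hv hv0)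
  have htt : t' = t := by
    refine (StrictMono.range_inj ht' ht).mp ?_
    have hsub : Finset.univ.image t' ⊆ Finset.univ.image t := by
      intro i hi
      obtain ⟨j, -, rfl⟩ := Finset.mem_image.mp hi
      obtain ⟨l, hl⟩ := hZt (t' j) fun h => by simpa [alternate, hvZ _ h] using hvt j
      exact Finset.mem_image.mpr ⟨l, Finset.mem_univ l, hl⟩
    have := Finset.eq_of_subset_of_card_le hsub (by
      rw [Finset.card_image_of_injective _ ht.injective,
        Finset.card_image_of_injective _ ht'.injective])
    simpa using congrArg (fun S : Finset (Fin n) => (S : Set (Fin n))) this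
  subst htt
  have hterm : ∀ j, e * f * (v (t' j) * w (t' j)) =
      (e * (-1) ^ (j : ℕ) * alternate v (t' j)) * (f * (-1) ^ (j : ℕ) * alternate w (t' j)) := by
    intro j
    have h1 : ((-1 : ℝ) ^ (j : ℕ)) * (-1) ^ (j : ℕ) = 1 := by rw [← mul_pow]; simp
    have h2 : ((-1 : ℝ) ^ (t' j : ℕ)) * (-1) ^ (t' j : ℕ) = 1 := by rw [← mul_pow]; simp
    simp only [alternate]
    linear_combination (-e * f * v (t' j) * w (t' j) * (-1 : ℝ) ^ (t' j : ℕ) * (-1) ^ (t' j : ℕ)) * h1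
      + (-e * f * v (t' j) * w (t' j)) * h2
  have hsum : ∑ j, v (t' j) * w (t' j) = 0 := by
    rw [← mem_orthComp_iff.mp hw v hv, ← Finset.sum_image (s := Finset.univ) (g := t')
      (f := fun i => v i * w i) (fun a _ b _ h => ht.injective h)]
    refine Finset.sum_subset (Finset.subset_univ _) fun i _ hi => ?_
    rw [hvZ i (by rwa [hZ, Finset.mem_compl]), zero_mul]
  have hzero : ∀ j, w (t' j) = 0 := by
    have h0 : ∑ j, e * f * (v (t' j) * w (t' j)) = 0 := by
      rw [← Finset.mul_sum, hsum, mul_zero]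
    intro j
    have hj := (Finset.sum_eq_zero_iff_of_nonneg fun j _ => by
      rw [hterm]
      exact mul_nonneg (hvt j).le (hwt j)).mp h0 j (Finset.mem_univ j)
    rw [hterm] at hj
    have hj' := (mul_eq_zero.mp hj).resolve_left (hvt j).ne'
    have hf0 : f ≠ 0 := by rcases hf with rfl | rfl <;> norm_num
    simpa [alternate, hf0] using hj'
  obtain ⟨i₀, hi₀⟩ := Function.ne_iff.mp hw0
  have hi₀Z : i₀ ∈ Z := by
    by_contra h
    obtain ⟨j, rfl⟩ := hZt i₀ h
    exact hi₀ (hzero j)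
  obtain ⟨u, hu, hu0, huZ⟩ := exists_mem_vanishing L (insert (t' 0) (Z.erase i₀)) (by
    rw [Finset.card_insert_of_notMem fun h => htZ 0 (Finset.mem_of_mem_erase h),
      Finset.card_erase_of_mem hi₀Z]
    have := Finset.card_pos.mpr ⟨i₀, hi₀Z⟩
    omega)
  have hui : u i₀ = 0 := by
    have h := mem_orthComp_iff.mp hw u hu
    rw [Finset.sum_eq_single i₀ _ (by simp)] at h
    · exact (mul_eq_zero.mp h).resolve_right hi₀
    · intro i _ hne
      by_cases hi : i ∈ Z
      · rw [huZ i (by simp [hi, hne]), zero_mul]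
      · obtain ⟨j, rfl⟩ := hZt i hi
        rw [hzero, mul_zero]
  refine hL u hu hu0 (altWeak_of_card_zeros hu0 (insert (t' 0) Z) ?_ fun i hi => ?_)
  · rw [Finset.card_insert_of_notMem (htZ 0)]
    omega
  · by_cases h : i = i₀
    · rw [h, hui]
    · exact huZ i (by simpa [h] using hi)

theorem isClosed_setOf_altWeak (n k : ℕ) : IsClosed {v : Fin n → ℝ | AltWeak v k} := by
  have h : {v : Fin n → ℝ | AltWeak v k} =
      ⋃ p : {s : Fin (k + 1) → Fin n // StrictMono s} × ({1, -1} : Set ℝ),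
        {v | ∀ j : Fin (k + 1), 0 ≤ (p.2 : ℝ) * (-1) ^ (j : ℕ) * v (p.1.1 j)} := by
    ext v
    simp only [Set.mem_iUnion, Set.mem_ofPred_eq]
    constructor
    · rintro ⟨s, hs, e, he, h⟩
      exact ⟨(⟨s, hs⟩, ⟨e, by simpa using he⟩), h⟩
    · rintro ⟨⟨⟨s, hs⟩, ⟨e, he⟩⟩, h⟩
      exact ⟨s, hs, e, by simpa using he, h⟩
  rw [h]
  refine isClosed_iUnion_of_finite fun p => ?_
  rw [Set.ofPred_forall]
  exact isClosed_iInter fun j => isClosed_le continuous_const (by fun_prop)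

theorem altWeak_of_mem_orthComp {n c : ℕ} {L : Submodule ℝ (Fin n → ℝ)}
    (hdim : Module.finrank ℝ L = c) (hL : ∀ v ∈ L, v ≠ 0 → ¬ AltStrict v c)
    {w : Fin n → ℝ} (hw : w ∈ orthComp L) (hw0 : w ≠ 0) : AltWeak w c := by
  by_contra hcon
  obtain ⟨A, hrank, rfl, hA⟩ := isNonnegSubspace_of_not_altStrict hdim hL
  obtain ⟨s₀, hs₀, hD⟩ := exists_minor_ne_zero hrank
  have hcont : Continuous fun G : Matrix (Fin n) (Fin n) ℝ => G.adjugate *ᵥ w :=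
    continuous_id.matrix_adjugate.matrix_mulVec continuous_const
  have hU : (fun G : Matrix (Fin n) (Fin n) ℝ => G.adjugate *ᵥ w) ⁻¹'
      ({u | AltWeak u c}ᶜ ∩ {0}ᶜ) ∈ 𝓝 1 := by
    refine (((isClosed_setOf_altWeak n c).isOpen_compl.inter
      isClosed_singleton.isOpen_compl).preimage hcont).mem_nhds ?_
    simpa using ⟨hcon, hw0⟩
  obtain ⟨G, ⟨hG, hG0⟩, hpos⟩ := hA.exists_allMinorsPos_mul hs₀ hD hU
  refine hG (altStrict_of_mem_orthComp (finrank_span_rows_of_minor_ne_zero (hpos s₀ hs₀).ne')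
    (fun v hv hv0 => hpos.not_altWeak hv hv0) (mem_orthComp_iff.mpr fun v hv => ?_) hG0).altWeak
  obtain ⟨y, rfl⟩ := (mem_span_rows_iff _ _).mp hv
  have horth : (y ᵥ* A) ⬝ᵥ w = 0 :=
    mem_orthComp_iff.mp hw _ ((mem_span_rows_iff A _).mpr ⟨y, rfl⟩)
  change (y ᵥ* (A * G)) ⬝ᵥ (G.adjugate *ᵥ w) = 0
  rw [dotProduct_mulVec, vecMul_vecMul, Matrix.mul_assoc, mul_adjugate, Matrix.mul_smul,
    Matrix.mul_one, vecMul_smul, smul_dotProduct, horth, smul_zero]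

theorem finrank_orthComp {n : ℕ} (L : Submodule ℝ (Fin n → ℝ)) :
    Module.finrank ℝ (orthComp L) = n - Module.finrank ℝ L := by
  have hmap : (orthComp L).map (dotProductEquiv ℝ (Fin n)).toLinearMap = L.dualAnnihilator := by
    ext φ
    rw [Submodule.mem_map_equiv, Submodule.mem_dualAnnihilator, mem_orthComp_iff]
    obtain ⟨w, rfl⟩ := (dotProductEquiv ℝ (Fin n)).surjective φ
    rw [LinearEquiv.symm_apply_apply]
    refine forall₂_congr fun v _ => ?_
    rw [dotProductEquiv_apply_apply, dotProduct_comm]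
    rfl
  have h := Subspace.finrank_add_finrank_dualAnnihilator_eq L
  rw [← hmap, LinearEquiv.finrank_map_eq, Module.finrank_fin_fun] at h
  omega

/-- `alternate` as a linear automorphism. -/
def alternateEquiv (n : ℕ) : (Fin n → ℝ) ≃ₗ[ℝ] (Fin n → ℝ) where
  toFun := alternate
  invFun := alternate
  map_add' v w := by
    ext i
    simp [alternate, mul_add]
  map_smul' a v := by
    ext i
    simp [alternate]
    ring
  left_inv := alternate_alternate
  right_inv := alternate_alternate

theorem mem_map_alternateEquiv {n : ℕ} {L : Submodule ℝ (Fin n → ℝ)} {v : Fin n → ℝ} :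
    v ∈ L.map (alternateEquiv n).toLinearMap ↔ alternate v ∈ L :=
  Submodule.mem_map_equiv (e := alternateEquiv n) L

theorem alternate_mem_orthComp_alternate_orthComp {n : ℕ} {L : Submodule ℝ (Fin n → ℝ)}
    {v : Fin n → ℝ} (hv : v ∈ L) :
    alternate v ∈ orthComp ((orthComp L).map (alternateEquiv n).toLinearMap) := by
  rw [mem_orthComp_iff]
  intro w hw
  rw [← mem_orthComp_iff.mp (mem_map_alternateEquiv.mp hw) v hv]
  refine Finset.sum_congr rfl fun i _ => ?_
  simp only [alternate]
  ring

theorem forall_not_altStrict_iff {n c : ℕ} {L : Submodule ℝ (Fin n → ℝ)}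
    (hdim : Module.finrank ℝ L = c) :
    (∀ v ∈ L, v ≠ 0 → ¬ AltStrict v c) ↔ ∀ w ∈ orthComp L, w ≠ 0 → AltWeak w c := by
  refine ⟨fun h w hw hw0 => altWeak_of_mem_orthComp hdim h hw hw0, fun h v hv hv0 hcon => ?_⟩
  have hcn := hcon.lt
  have hweak : AltWeak (alternate v) (n - c) :=
    altWeak_of_mem_orthComp (by rw [LinearEquiv.finrank_map_eq, finrank_orthComp, hdim])
      (fun w hw hw0 hs => by
        have := hs.add_lt_of_altWeak_alternate
          (h _ (mem_map_alternateEquiv.mp hw) (alternate_ne_zero hw0))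
        omega)
      (alternate_mem_orthComp_alternate_orthComp hv) (alternate_ne_zero hv0)
  have := hcon.add_lt_of_altWeak_alternate hweak
  omega

theorem forall_not_altWeak_iff {n c : ℕ} {L : Submodule ℝ (Fin n → ℝ)}
    (hdim : Module.finrank ℝ L = c) :
    (∀ v ∈ L, v ≠ 0 → ¬ AltWeak v c) ↔ ∀ w ∈ orthComp L, w ≠ 0 → AltStrict w c := by
  refine ⟨fun h w hw hw0 => altStrict_of_mem_orthComp hdim h hw hw0, fun h v hv hv0 hcon => ?_⟩
  have hcn : c ≤ n := by
    rw [← hdim]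
    simpa using Submodule.finrank_le L
  have hstrict : AltStrict (alternate v) (n - c) :=
    altStrict_of_mem_orthComp (by rw [LinearEquiv.finrank_map_eq, finrank_orthComp, hdim])
      (fun w hw hw0 hs => by
        have := (h _ (mem_map_alternateEquiv.mp hw)
          (alternate_ne_zero hw0)).add_lt_of_altWeak_alternate (by rwa [alternate_alternate])
        omega)
      (alternate_mem_orthComp_alternate_orthComp hv) (alternate_ne_zero hv0)
  have := hstrict.add_lt_of_altWeak_alternate (by rwa [alternate_alternate])
  omega

/-- Gantmacher–Krein.  For a `c`-dimensional subspace `L ⊆ ℝⁿ`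
(`1 ≤ c ≤ n`): (1) `L` is nonnegative iff `var v < c` for all nonzero `v ∈ L`, iff
`varbar w ≥ c` for all nonzero `w ∈ L^⊥`; (2) `L` is positive iff `varbar v < c` for all
nonzero `v ∈ L`, iff `var w ≥ c` for all nonzero `w ∈ L^⊥`. -/
theorem stmt19 {n c : ℕ} (hc1 : 1 ≤ c) (hc2 : c ≤ n) (L : Submodule ℝ (Fin n → ℝ))
    (hdim : Module.finrank ℝ L = c) :
    ((IsNonnegSubspace c L ↔ ∀ v ∈ L, v ≠ 0 → var v < c) ∧
     (IsNonnegSubspace c L ↔ ∀ w ∈ orthComp L, w ≠ 0 → c ≤ varbar w)) ∧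
    ((IsPositiveSubspace c L ↔ ∀ v ∈ L, v ≠ 0 → varbar v < c) ∧
     (IsPositiveSubspace c L ↔ ∀ w ∈ orthComp L, w ≠ 0 → c ≤ var w)) := by
  have h1 : IsNonnegSubspace c L ↔ ∀ v ∈ L, v ≠ 0 → ¬ AltStrict v c :=
    ⟨fun h v hv _ => h.not_altStrict hv, isNonnegSubspace_of_not_altStrict hdim⟩
  have h2 : IsPositiveSubspace c L ↔ ∀ v ∈ L, v ≠ 0 → ¬ AltWeak v c := by
    refine ⟨?_, isPositiveSubspace_of_not_altWeak hdim⟩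
    rintro ⟨A, -, rfl, hA⟩ v hv hv0
    exact hA.not_altWeak hv hv0
  refine ⟨⟨h1.trans ?_, (h1.trans (forall_not_altStrict_iff hdim)).trans ?_⟩,
    h2.trans ?_, (h2.trans (forall_not_altWeak_iff hdim)).trans ?_⟩
  · exact forall₃_congr fun v _ hv0 => (var_lt_iff hv0).symm
  · exact forall₃_congr fun w _ hw0 => (le_varbar_iff hw0).symm
  · exact forall₃_congr fun v _ hv0 => (varbar_lt_iff hv0).symm
  · exact forall₃_congr fun w _ hw0 => (le_var_iff hw0).symm
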